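/- arXiv:1806.03315 — 7 statements merged into one kernel-verified Lean document; each statement's English description precedes it below -/
import Mathlib

section
/- Let V be a finite type and r : V → V → Prop a digraph. Then r contains two vertex-disjoint simple cycles if and only if there exist a nonempty finite subset K of V and a permutation π of V fixing every vertex outside K, such that r i (π i) holds for every i ∈ K and the number of orbits of π contained in K (counting fixed points in K as orbits) is even. -/
/-- A simple directed cycle of the digraph `r`: a nonempty list of pairwise distinct
vertices with `r` holding between consecutive entries and from the last entry back to
the first (the appended `l.take 1` supplies the closing edge; a single vertex `v` with
`r v v` is a simple cycle of length 1). -/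
def IsSimpleCycle {V : Type*} (r : V → V → Prop) (l : List V) : Prop :=
  l ≠ [] ∧ l.Nodup ∧ List.Chain' r (l ++ l.take 1)

/-- The setoid whose classes are the orbits of a permutation `π`: the equivalence
relation generated by `x ~ π x` (fixed points give singleton orbits). -/
def orbitSetoid {α : Type*} (π : Equiv.Perm α) : Setoid α :=
  Relation.EqvGen.setoid fun x y => π x = y

theorem orbitSetoid_mk_eq_iff {α : Type*} (π : Equiv.Perm α) (x y : α) :
    Quotient.mk (orbitSetoid π) x = Quotient.mk (orbitSetoid π) y ↔ π.SameCycle x y := by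
  rw [Quotient.eq]
  change Relation.EqvGen _ x y ↔ _
  constructor
  · intro h
    induction h with
    | rel x y h => exact ⟨1, by simpa using h⟩
    | refl x => exact .refl π x
    | symm x y _ ih => exact ih.symm
    | trans x y z _ _ ih₁ ih₂ => exact ih₁.trans ih₂
  · have hpow : ∀ (n : ℕ) (z : α), Relation.EqvGen (fun x y => π x = y) z ((π ^ n) z) := by
      intro n z
      induction n with
      | zero => exact .refl z
      | succ n ih => exact ih.trans _ _ _ (.rel _ _ (by rw [pow_succ', Equiv.Perm.mul_apply]))
    rintro ⟨n | n, rfl⟩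
    · simpa using hpow n x
    · simpa using (hpow (n + 1) ((π ^ Int.negSucc n) x)).symm

theorem Equiv.Perm.SameCycle.mem_of_mapsTo {α : Type*} [Finite α] {π : Equiv.Perm α} {s : Set α}
    (hs : ∀ x ∈ s, π x ∈ s) {x y : α} (h : π.SameCycle x y) (hx : x ∈ s) : y ∈ s := by
  obtain ⟨n, -, rfl⟩ := h.exists_pow_eq'
  clear h
  induction n with
  | zero => exact hx
  | succ n ih => rw [pow_succ', Equiv.Perm.mul_apply]; exact hs _ ih

theorem List.sameCycle_iff_mem_of_eq_formPerm {α : Type*} [Finite α] [DecidableEq α]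
    {π : Equiv.Perm α} {l : List α} (hl : l.Nodup) (h : ∀ x ∈ l, π x = l.formPerm x)
    {x y : α} (hx : x ∈ l) : π.SameCycle x y ↔ y ∈ l := by
  refine ⟨fun hxy => hxy.mem_of_mapsTo (s := {z | z ∈ l}) (fun z hz => ?_) hx, fun hy => ?_⟩
  · simp only [Set.mem_ofPred_eq] at hz ⊢
    rw [h z hz]
    exact List.formPerm_apply_mem_of_mem hz
  · have key : ∀ (i : ℕ) (hi : i < l.length), π.SameCycle (l[0]'(by omega)) l[i] := by
      intro i
      induction i with
      | zero => exact fun _ => .refl _ _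
      | succ i ih =>
        intro hi
        refine (ih (by omega)).trans ⟨1, ?_⟩
        rw [zpow_one, h _ (List.getElem_mem _), List.formPerm_apply_lt_getElem _ hl _ hi]
    obtain ⟨i, hi, rfl⟩ := List.mem_iff_getElem.mp hx
    obtain ⟨j, hj, rfl⟩ := List.mem_iff_getElem.mp hy
    exact (key i hi).symm.trans (key j hj)

theorem IsSimpleCycle.rel_formPerm {V : Type*} [DecidableEq V] {r : V → V → Prop} {l : List V}
    (h : IsSimpleCycle r l) {x : V} (hx : x ∈ l) : r x (l.formPerm x) := by
  obtain ⟨hne, hnd, hc⟩ := h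
  obtain ⟨i, hi, rfl⟩ := List.mem_iff_getElem.mp hx
  rw [List.formPerm_apply_getElem _ hnd]
  have hlen : (l.take 1).length = 1 := by simp; omega
  have hr := List.isChain_iff_getElem.mp hc i (by rw [List.length_append]; omega)
  rw [List.getElem_append_left hi] at hr
  rcases Nat.lt_or_ge (i + 1) l.length with hlt | hge
  · rw [List.getElem_append_left hlt] at hr
    simpa only [Nat.mod_eq_of_lt hlt] using hr
  · have heq : i + 1 = l.length := by omega
    rw [List.getElem_append_right hge] at hr
    simpa [heq] using hr

/-- An orbit of `π` along which `r i (π i)` holds is the vertex set of a simple cycle. -/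
theorem exists_isSimpleCycle_of_sameCycle {V : Type*} [Finite V] {r : V → V → Prop}
    (π : Equiv.Perm V) (x : V) (h : ∀ y, π.SameCycle x y → r y (π y)) :
    ∃ l : List V, IsSimpleCycle r l ∧ ∀ y ∈ l, π.SameCycle x y := by
  have hpos : 0 < Function.minimalPeriod π x :=
    Function.minimalPeriod_pos_of_mem_periodicPts
      (π.injective.mem_periodicPts x)
  have hsame : ∀ k : ℕ, π.SameCycle x (π^[k] x) := fun k =>
    ⟨k, by rw [zpow_natCast, Equiv.Perm.iterate_eq_pow]⟩
  refine ⟨(List.range (Function.minimalPeriod π x)).map fun k => π^[k] x,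
    ⟨by simpa using hpos.ne', ?_, ?_⟩, ?_⟩
  · refine List.Nodup.map_on (fun i hi j hj hij => ?_) List.nodup_range
    rw [List.mem_range] at hi hj
    exact Function.iterate_injOn_Iio_minimalPeriod hi hj hij
  · have heq : ((List.range (Function.minimalPeriod π x)).map fun k => π^[k] x) ++
        ((List.range (Function.minimalPeriod π x)).map fun k => π^[k] x).take 1 =
        (List.range (Function.minimalPeriod π x + 1)).map fun k => π^[k] x := by
      rw [List.range_succ, List.map_append, ← List.map_take, List.take_range,
        Nat.min_eq_left hpos]
      simp [Function.iterate_minimalPeriod]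
    rw [heq]
    refine List.isChain_iff_getElem.mpr fun i hi => ?_
    simp only [List.getElem_map, List.getElem_range, Function.iterate_succ_apply']
    exact h _ (hsame i)
  · intro y hy
    obtain ⟨k, -, rfl⟩ := List.mem_map.mp hy
    exact hsame k

/-- A digraph `r` on a finite type `V` contains two vertex-disjoint
simple cycles iff there are a nonempty finite `K ⊆ V` and a permutation `π` of `V`
fixing every vertex outside `K`, with `r i (π i)` for every `i ∈ K`, such that the
number of orbits of `π` contained in `K` is even. -/
theorem two_disjoint_cycles_iff_even_orbits {V : Type*} [Fintype V] (r : V → V → Prop) :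
    (∃ l₁ l₂ : List V, IsSimpleCycle r l₁ ∧ IsSimpleCycle r l₂ ∧ ∀ v ∈ l₁, v ∉ l₂) ↔
      ∃ (K : Finset V) (π : Equiv.Perm V), K.Nonempty ∧ (∀ i ∉ K, π i = i) ∧
        (∀ i ∈ K, r i (π i)) ∧
        Even (Nat.card
          {o : Quotient (orbitSetoid π) // ∀ x, Quotient.mk (orbitSetoid π) x = o → x ∈ K}) := by
  classical
  constructor
  · rintro ⟨l₁, l₂, h₁, h₂, hd⟩
    have hd' : ∀ v ∈ l₂, v ∉ l₁ := fun v hv hv' => hd v hv' hv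
    obtain ⟨a, ha⟩ := List.exists_mem_of_ne_nil l₁ h₁.1
    obtain ⟨b, hb⟩ := List.exists_mem_of_ne_nil l₂ h₂.1
    set π : Equiv.Perm V := l₁.formPerm * l₂.formPerm with hπ
    have hπ₁ : ∀ x ∈ l₁, π x = l₁.formPerm x := fun x hx => by
      rw [hπ, Equiv.Perm.mul_apply, List.formPerm_apply_of_notMem (hd x hx)]
    have hπ₂ : ∀ x ∈ l₂, π x = l₂.formPerm x := fun x hx => by
      rw [hπ, Equiv.Perm.mul_apply,
        List.formPerm_apply_of_notMem (hd' _ (List.formPerm_apply_mem_of_mem hx))]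
    have ho₁ : ∀ {x y}, x ∈ l₁ → (π.SameCycle x y ↔ y ∈ l₁) :=
      List.sameCycle_iff_mem_of_eq_formPerm h₁.2.1 hπ₁
    have ho₂ : ∀ {x y}, x ∈ l₂ → (π.SameCycle x y ↔ y ∈ l₂) :=
      List.sameCycle_iff_mem_of_eq_formPerm h₂.2.1 hπ₂
    refine ⟨l₁.toFinset ∪ l₂.toFinset, π, ⟨a, by simp [ha]⟩, fun i hi => ?_, fun i hi => ?_, ?_⟩
    · simp only [Finset.mem_union, List.mem_toFinset, not_or] at hi
      rw [hπ, Equiv.Perm.mul_apply, List.formPerm_apply_of_notMem hi.2,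
        List.formPerm_apply_of_notMem hi.1]
    · simp only [Finset.mem_union, List.mem_toFinset] at hi
      rcases hi with hi | hi
      · rw [hπ₁ i hi]
        exact h₁.rel_formPerm hi
      · rw [hπ₂ i hi]
        exact h₂.rel_formPerm hi
    · suffices h : Nat.card {o : Quotient (orbitSetoid π) //
          ∀ x, Quotient.mk (orbitSetoid π) x = o → x ∈ l₁.toFinset ∪ l₂.toFinset} = 2 from
        h ▸ even_two
      refine Nat.card_eq_two_iff.mpr ⟨⟨Quotient.mk _ a, fun x hx => ?_⟩,
        ⟨Quotient.mk _ b, fun x hx => ?_⟩, fun hab => ?_, ?_⟩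
      · have := (ho₁ ha).mp ((orbitSetoid_mk_eq_iff π _ _).mp hx.symm)
        simp [this]
      · have := (ho₂ hb).mp ((orbitSetoid_mk_eq_iff π _ _).mp hx.symm)
        simp [this]
      · have := (ho₁ ha).mp ((orbitSetoid_mk_eq_iff π _ _).mp (congrArg Subtype.val hab))
        exact hd b this hb
      · refine Set.eq_univ_of_forall ?_
        rintro ⟨o, ho⟩
        induction o using Quotient.inductionOn with
        | h x =>
          have hx := ho x rfl
          simp only [Finset.mem_union, List.mem_toFinset] at hx
          rcases hx with hx | hx
          · exact Or.inl (Subtype.ext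
              ((orbitSetoid_mk_eq_iff π _ _).mpr ((ho₁ hx).mpr ha)))
          · exact Or.inr (Subtype.ext
              ((orbitSetoid_mk_eq_iff π _ _).mpr ((ho₂ hx).mpr hb)))
  · rintro ⟨K, π, ⟨a, ha⟩, hfix, hr, heven⟩
    have hK : ∀ x ∈ (K : Set V), π x ∈ (K : Set V) := fun x hx => by
      by_contra hn
      exact hn ((π.injective (hfix _ hn)).symm ▸ hx)
    have : Nonempty {o : Quotient (orbitSetoid π) //
        ∀ x, Quotient.mk (orbitSetoid π) x = o → x ∈ K} :=
      ⟨Quotient.mk _ a, fun x hx =>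
        ((orbitSetoid_mk_eq_iff π _ _).mp hx.symm).mem_of_mapsTo hK ha⟩
    have hcard := Nat.card_pos (α := {o : Quotient (orbitSetoid π) //
        ∀ x, Quotient.mk (orbitSetoid π) x = o → x ∈ K})
    obtain ⟨m, hm⟩ := heven
    obtain ⟨⟨o₁, ho₁⟩, ⟨o₂, ho₂⟩, hne⟩ := (Finite.one_lt_card_iff_nontrivial
      (α := {o : Quotient (orbitSetoid π) //
        ∀ x, Quotient.mk (orbitSetoid π) x = o → x ∈ K}).mp (by omega)).exists_pair_ne
    obtain ⟨x₁, rfl⟩ := Quotient.exists_rep o₁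
    obtain ⟨x₂, rfl⟩ := Quotient.exists_rep o₂
    obtain ⟨l₁, hl₁, hs₁⟩ := exists_isSimpleCycle_of_sameCycle π x₁ fun y hy =>
      hr y (ho₁ y ((orbitSetoid_mk_eq_iff π _ _).mpr hy.symm))
    obtain ⟨l₂, hl₂, hs₂⟩ := exists_isSimpleCycle_of_sameCycle π x₂ fun y hy =>
      hr y (ho₂ y ((orbitSetoid_mk_eq_iff π _ _).mpr hy.symm))
    exact ⟨l₁, l₂, hl₁, hl₂, fun v hv₁ hv₂ => hne (Subtype.ext
      ((orbitSetoid_mk_eq_iff π _ _).mpr ((hs₁ v hv₁).trans (hs₂ v hv₂).symm)))⟩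
end

section
/- Let S be a commutative semiring, d a natural number, and A a d × d matrix over S. Suppose the support digraph of A (with an edge from i to j if and only if A i j ≠ 0) contains no two vertex-disjoint simple cycles. Then for every nonempty finite subset K of Fin d and every permutation π of Fin d fixing every index outside K such that the number of orbits of π contained in K (counting fixed points in K as orbits) is even, the product ∏_{i ∈ K} A i (π i) equals 0. -/
theorem orbitSetoid_apply {α : Type*} (π : Equiv.Perm α) (x : α) : orbitSetoid π x (π x) :=
  Relation.EqvGen.rel _ _ rfl

theorem orbitSetoid_iterate {α : Type*} (π : Equiv.Perm α) (x : α) (n : ℕ) :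
    orbitSetoid π x (π^[n] x) := by
  induction n with
  | zero => exact Relation.EqvGen.refl _
  | succ n ih =>
    rw [Function.iterate_succ_apply']
    exact Relation.EqvGen.trans _ _ _ ih (orbitSetoid_apply π _)

/-- A set containing every non-fixed point of `π` is a union of orbits of `π`. -/
theorem mem_iff_of_orbitSetoid {α : Type*} {π : Equiv.Perm α} {K : Finset α}
    (hK : ∀ i ∉ K, π i = i) {x y : α} (h : orbitSetoid π x y) : x ∈ K ↔ y ∈ K := by
  induction h with
  | rel x y h =>
    subst h
    refine ⟨fun hx => by_contra fun hy => ?_, fun hy => by_contra fun hx => ?_⟩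
    · exact hy (by rwa [π.injective (hK _ hy)])
    · exact hx (by rwa [hK _ hx] at hy)
  | refl => rfl
  | symm _ _ _ ih => exact ih.symm
  | trans _ _ _ _ _ ih₁ ih₂ => exact ih₁.trans ih₂

/-- If `r y (π y)` holds along the orbit of `x`, then the orbit supports a simple cycle of `r`. -/
theorem exists_isSimpleCycle_of_orbit {α : Type*} [Finite α] {r : α → α → Prop}
    (π : Equiv.Perm α) (x : α) (h : ∀ y, orbitSetoid π x y → r y (π y)) :
    ∃ l, IsSimpleCycle r l ∧ ∀ y ∈ l, orbitSetoid π x y := by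
  have hx : x ∈ Function.periodicPts π := π.injective.mem_periodicPts x
  have hpos := Function.minimalPeriod_pos_of_mem_periodicPts hx
  set n := Function.minimalPeriod π x
  refine ⟨(List.range n).map fun k => π^[k] x, ⟨?_, ?_, ?_⟩, ?_⟩
  · simp [hpos.ne']
  · refine List.Nodup.map_on (fun i hi j hj hij => ?_) List.nodup_range
    exact Function.iterate_injOn_Iio_minimalPeriod (List.mem_range.1 hi) (List.mem_range.1 hj) hij
  · have key : ((List.range n).map fun k => π^[k] x) ++
        ((List.range n).map fun k => π^[k] x).take 1 =
        (List.range (n + 1)).map fun k => π^[k] x := by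
      have hp : π^[n] x = x := Function.iterate_minimalPeriod
      rw [List.range_succ, List.map_append, ← List.map_take, List.take_range,
        min_eq_left (Nat.succ_le_of_lt hpos)]
      simp [hp]
    rw [key]
    refine List.isChain_iff_getElem.2 fun i hi => ?_
    simp only [List.getElem_map, List.getElem_range, Function.iterate_succ_apply']
    exact h _ (orbitSetoid_iterate π x i)
  · intro y hy
    obtain ⟨k, -, rfl⟩ := List.mem_map.1 hy
    exact orbitSetoid_iterate π x k

/-- Let `A` be a `d × d` matrix over a commutative semiring whose
support digraph (edge `i → j` iff `A i j ≠ 0`) has no two vertex-disjoint simple cycles.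
Then for every nonempty finite `K` and permutation `π` fixing every index outside `K`
with an even number of orbits contained in `K`, the product `∏ i ∈ K, A i (π i)` is `0`. -/
theorem prod_eq_zero_of_even_orbits {S : Type*} [CommSemiring S] {d : ℕ}
    (A : Matrix (Fin d) (Fin d) S)
    (hA : ¬ ∃ l₁ l₂ : List (Fin d),
        IsSimpleCycle (fun i j => A i j ≠ 0) l₁ ∧
        IsSimpleCycle (fun i j => A i j ≠ 0) l₂ ∧ ∀ v ∈ l₁, v ∉ l₂) :
    ∀ (K : Finset (Fin d)), K.Nonempty → ∀ π : Equiv.Perm (Fin d),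
      (∀ i ∉ K, π i = i) →
      Even (Nat.card
        {o : Quotient (orbitSetoid π) // ∀ x, Quotient.mk (orbitSetoid π) x = o → x ∈ K}) →
      ∏ i ∈ K, A i (π i) = 0 := by
  intro K ⟨x, hx⟩ π hK heven
  by_contra hprod
  have hne : ∀ i ∈ K, A i (π i) ≠ 0 := fun i hi h => hprod (Finset.prod_eq_zero hi h)
  have hcycle : ∀ z ∈ K, ∃ l, IsSimpleCycle (fun i j => A i j ≠ 0) l ∧
      ∀ y ∈ l, orbitSetoid π z y := fun z hz =>
    exists_isSimpleCycle_of_orbit π z fun y hy => hne y ((mem_iff_of_orbitSetoid hK hy).1 hz)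
  have hcard : 1 < Nat.card
      {o : Quotient (orbitSetoid π) // ∀ x, Quotient.mk (orbitSetoid π) x = o → x ∈ K} := by
    have : Nonempty
        {o : Quotient (orbitSetoid π) // ∀ x, Quotient.mk (orbitSetoid π) x = o → x ∈ K} :=
      ⟨Quotient.mk _ x, fun y hy => (mem_iff_of_orbitSetoid hK (Quotient.exact hy)).2 hx⟩
    obtain ⟨m, hm⟩ := heven
    have := Nat.card_pos (α :=
      {o : Quotient (orbitSetoid π) // ∀ x, Quotient.mk (orbitSetoid π) x = o → x ∈ K})
    omega
  obtain ⟨⟨⟨o₁, h₁⟩, ⟨o₂, h₂⟩, hne'⟩⟩ := Finite.one_lt_card_iff_nontrivial.1 hcard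
  induction o₁ using Quotient.inductionOn with | h a => ?_
  induction o₂ using Quotient.inductionOn with | h b => ?_
  obtain ⟨l₁, hl₁, ha⟩ := hcycle a (h₁ a rfl)
  obtain ⟨l₂, hl₂, hb⟩ := hcycle b (h₂ b rfl)
  refine hA ⟨l₁, l₂, hl₁, hl₂, fun v hv₁ hv₂ => hne' (Subtype.ext (Quotient.sound ?_))⟩
  exact (orbitSetoid π).trans (ha v hv₁) ((orbitSetoid π).symm (hb v hv₂))
end

section
/- Let R be a commutative ring, d ≥ 1, and A a d × d matrix over R whose support digraph (edge from i to j iff A i j ≠ 0) contains no two vertex-disjoint simple cycles. Then for every k with 1 ≤ k ≤ d, the coefficient of λ^{d-k} in the characteristic polynomial of A equals the negative of the sum, over all size-k subsets K of Fin d and all permutations π of Fin d that fix every index outside K and have exactly one orbit inside K (a single k-cycle on K; for k = 1 this means a fixed point), of the products ∏_{i ∈ K} A i (π i). -/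
open scoped Classical

theorem orbitSetoid_iff_sameCycle {α : Type*} (π : Equiv.Perm α) (x y : α) :
    orbitSetoid π x y ↔ π.SameCycle x y := by
  change Relation.EqvGen _ x y ↔ _
  constructor
  · intro h
    induction h with
    | rel x y h => exact ⟨1, by simpa using h⟩
    | refl x => exact Equiv.Perm.SameCycle.refl _ _
    | symm x y _ ih => exact ih.symm
    | trans x y z _ _ ih₁ ih₂ => exact ih₁.trans ih₂
  · rintro ⟨n, rfl⟩
    induction n with
    | zero => exact Relation.EqvGen.refl _
    | succ n ih =>
      refine ih.trans _ _ _ (Relation.EqvGen.rel _ _ ?_)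
      rw [add_comm, zpow_add, zpow_one, Equiv.Perm.mul_apply]
    | pred n ih =>
      refine ih.trans _ _ _ (Relation.EqvGen.symm _ _ (Relation.EqvGen.rel _ _ ?_))
      rw [← Equiv.Perm.mul_apply, ← zpow_one_add, add_sub_cancel]

/-- If `π` fixes everything outside `K`, then membership in `K` is invariant on cycles. -/
theorem Equiv.Perm.SameCycle.mem_of_fixes_compl {α : Type*} {π : Equiv.Perm α} {K : Finset α}
    (hπ : ∀ i ∉ K, π i = i) {x y : α} (h : π.SameCycle x y) (hx : x ∈ K) : y ∈ K := by
  by_contra hy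
  exact hy (h.eq_of_right (hπ y hy) ▸ hx)

theorem apply_mem_iff_of_fixes_compl {α : Type*} {π : Equiv.Perm α} {K : Finset α}
    (hπ : ∀ i ∉ K, π i = i) (x : α) : π x ∈ K ↔ x ∈ K :=
  ⟨Equiv.Perm.SameCycle.mem_of_fixes_compl hπ ⟨-1, by simp⟩,
    Equiv.Perm.SameCycle.mem_of_fixes_compl hπ ⟨1, by simp⟩⟩

theorem card_orbits_eq_one_iff_isCycleOn {α : Type*} {π : Equiv.Perm α} {K : Finset α}
    (hK : K.Nonempty) (hπ : ∀ i ∉ K, π i = i) :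
    Nat.card {o : Quotient (orbitSetoid π) //
        ∀ x, Quotient.mk (orbitSetoid π) x = o → x ∈ K} = 1 ↔ π.IsCycleOn K := by
  have hmk (x y : α) : Quotient.mk (orbitSetoid π) x = Quotient.mk (orbitSetoid π) y ↔
      π.SameCycle x y := Quotient.eq.trans (orbitSetoid_iff_sameCycle π x y)
  have hmem {x : α} (hx : x ∈ K) (y : α)
      (h : Quotient.mk (orbitSetoid π) y = Quotient.mk (orbitSetoid π) x) : y ∈ K :=
    ((hmk y x).1 h).symm.mem_of_fixes_compl hπ hx
  rw [Nat.card_eq_one_iff_unique]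
  constructor
  · rintro ⟨hs, -⟩
    exact ⟨π.bijOn (apply_mem_iff_of_fixes_compl hπ), fun x hx y hy => (hmk x y).1
      (congrArg Subtype.val (hs.elim ⟨Quotient.mk _ x, hmem hx⟩ ⟨Quotient.mk _ y, hmem hy⟩))⟩
  · intro h
    obtain ⟨a, ha⟩ := hK
    refine ⟨⟨?_⟩, ⟨⟨Quotient.mk _ a, hmem ha⟩⟩⟩
    rintro ⟨o₁, h₁⟩ ⟨o₂, h₂⟩
    induction o₁ using Quotient.inductionOn with | _ x
    induction o₂ using Quotient.inductionOn with | _ y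
    exact Subtype.ext ((hmk x y).2 (h.2 (h₁ x rfl) (h₂ y rfl)))

theorem sign_of_isCycleOn {α : Type*} [Fintype α] [DecidableEq α] {π : Equiv.Perm α}
    {K : Finset α} (hK : K.Nonempty) (hπ : ∀ i ∉ K, π i = i) (h : π.IsCycleOn K) :
    Equiv.Perm.sign π = -(-1) ^ K.card := by
  obtain ⟨a, ha⟩ := hK
  obtain rfl | hs := Finset.eq_singleton_or_nontrivial ha
  · have : π = 1 := by
      ext i
      by_cases hi : i ∈ ({a} : Finset α)
      · rw [Finset.coe_singleton, Equiv.Perm.isCycleOn_singleton] at h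
        rw [Finset.mem_singleton.1 hi, h, Equiv.Perm.one_apply]
      · exact hπ i hi
    simp [this]
  · have hc : π.IsCycle := Equiv.Perm.isCycle_iff_exists_isCycleOn.2
      ⟨K, hs, h, fun x hx => by_contra fun hxK => hx (hπ x hxK)⟩
    have hsupp : π.support = K := by
      ext i
      rw [Equiv.Perm.mem_support]
      exact ⟨fun hi => by_contra fun hiK => hi (hπ i hiK), fun hi => h.apply_ne hs hi⟩
    rw [hc.sign, hsupp]

/-- The cycle of a permutation through a point is a simple cycle of any digraph containing the
edges `y → π y` along it. -/
theorem exists_isSimpleCycle_of_perm {V : Type*} [Finite V] {r : V → V → Prop}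
    (π : Equiv.Perm V) (x : V) (h : ∀ y, π.SameCycle x y → r y (π y)) :
    ∃ l, IsSimpleCycle r l ∧ ∀ y ∈ l, π.SameCycle x y := by
  set n := Function.minimalPeriod π x with hn
  have hpos : 0 < n := Function.minimalPeriod_pos_of_mem_periodicPts
    (π.injective.mem_periodicPts x)
  have hsame (i : ℕ) : π.SameCycle x (π^[i] x) := ⟨i, by simp [Equiv.Perm.iterate_eq_pow]⟩
  refine ⟨(List.range n).map fun i => π^[i] x, ⟨?_, ?_, ?_⟩, ?_⟩
  · simp [hpos.ne']
  · refine (List.nodup_map_iff_inj_on List.nodup_range).2 fun i hi j hj hij => ?_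
    exact Function.iterate_injOn_Iio_minimalPeriod (List.mem_range.1 hi) (List.mem_range.1 hj) hij
  · have hlist : ((List.range n).map fun i => π^[i] x) ++
        ((List.range n).map fun i => π^[i] x).take 1 =
        (List.range (n + 1)).map fun i => π^[i] x := by
      obtain ⟨m, hm⟩ := Nat.exists_eq_succ_of_ne_zero hpos.ne'
      have hper : π^[n] x = x := Function.iterate_minimalPeriod
      rw [List.range_succ, List.map_append, List.map_singleton, hper, hm, ← List.map_take,
        List.take_range]
      simp
    rw [hlist]
    change List.IsChain r _
    rw [List.isChain_map, List.isChain_range_succ]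
    intro i _
    rw [Function.iterate_succ_apply']
    exact h _ (hsame i)
  · rintro y hy
    obtain ⟨i, -, rfl⟩ := List.mem_map.1 hy
    exact hsame i

theorem det_submatrix_eq_sum_perm {n R : Type*} [Fintype n] [DecidableEq n] [CommRing R]
    (A : Matrix n n R) (K : Finset n) :
    (A.submatrix (Subtype.val : K → n) (Subtype.val : K → n)).det =
      ∑ π ∈ Finset.univ.filter (fun π : Equiv.Perm n => ∀ i ∉ K, π i = i),
        (Equiv.Perm.sign π : ℤ) • ∏ i ∈ K, A i (π i) := by
  rw [← Matrix.det_transpose, Matrix.det_apply]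
  refine Finset.sum_bij (fun σ _ => Equiv.Perm.ofSubtype σ) ?_ ?_ ?_ ?_
  · intro σ _
    simpa using fun i hi => Equiv.Perm.ofSubtype_apply_of_not_mem σ hi
  · exact fun σ _ τ _ h => Equiv.Perm.ofSubtype_injective h
  · intro π hπ
    have hπ' := (Finset.mem_filter.1 hπ).2
    exact ⟨π.subtypePerm (apply_mem_iff_of_fixes_compl hπ'), Finset.mem_univ _,
      Equiv.Perm.ofSubtype_subtypePerm _ fun x hx => by_contra fun hxK => hx (hπ' x hxK)⟩
  · intro σ _
    rw [Equiv.Perm.sign_ofSubtype, ← Finset.prod_coe_sort K]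
    simp [Units.smul_def]

/-- Let `A` be a `d × d` matrix (`d ≥ 1`) over a commutative ring whose
support digraph (edge `i → j` iff `A i j ≠ 0`) has no two vertex-disjoint simple cycles.
Then for `1 ≤ k ≤ d`, the coefficient of `λ^(d-k)` in the characteristic polynomial of
`A` is the negative of the sum, over all size-`k` subsets `K` and all permutations `π`
fixing every index outside `K` and having exactly one orbit inside `K` (a single
`k`-cycle on `K`; a fixed point when `k = 1`), of `∏ i ∈ K, A i (π i)`. -/
theorem charpoly_coeff_eq_neg_sum_cycles {R : Type*} [CommRing R] {d : ℕ} (hd : 1 ≤ d)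
    (A : Matrix (Fin d) (Fin d) R)
    (hA : ¬ ∃ l₁ l₂ : List (Fin d),
        IsSimpleCycle (fun i j => A i j ≠ 0) l₁ ∧
        IsSimpleCycle (fun i j => A i j ≠ 0) l₂ ∧ ∀ v ∈ l₁, v ∉ l₂)
    (k : ℕ) (hk1 : 1 ≤ k) (hkd : k ≤ d) :
    (Matrix.charpoly A).coeff (d - k) =
      - ∑ K ∈ Finset.univ.filter (fun K : Finset (Fin d) => K.card = k),
          ∑ π ∈ Finset.univ.filter (fun π : Equiv.Perm (Fin d) =>
              (∀ i ∉ K, π i = i) ∧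
              Nat.card {o : Quotient (orbitSetoid π) //
                  ∀ x, Quotient.mk (orbitSetoid π) x = o → x ∈ K} = 1),
            ∏ i ∈ K, A i (π i) := by
  have hcard := Matrix.charpoly_coeff_eq_sum_minors A k (by simpa using hkd)
  rw [Fintype.card_fin] at hcard
  rw [hcard, Finset.mul_sum, ← Finset.sum_neg_distrib]
  refine Finset.sum_congr (by ext; simp) fun K hK => ?_
  replace hK : K.card = k := (Finset.mem_filter.1 hK).2
  have hKne : K.Nonempty := Finset.card_pos.1 (by omega)
  rw [← Finset.filter_filter, ← Finset.sum_neg_distrib, Finset.sum_filter,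
    det_submatrix_eq_sum_perm, Finset.mul_sum]
  refine Finset.sum_congr (by ext; simp) fun π hπ => ?_
  replace hπ := (Finset.mem_filter.1 hπ).2
  simp only [card_orbits_eq_one_iff_isCycleOn hKne hπ]
  split_ifs with hc
  · rw [sign_of_isCycleOn hKne hπ hc, hK]
    rcases Nat.even_or_odd k with e | e <;> simp [e.neg_one_pow]
  · suffices ∏ i ∈ K, A i (π i) = 0 by simp [this]
    by_contra hne
    have hedge (i : Fin d) (hi : i ∈ K) : A i (π i) ≠ 0 :=
      fun h0 => hne (Finset.prod_eq_zero hi h0)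
    refine hc ⟨π.bijOn (apply_mem_iff_of_fixes_compl hπ),
      fun x hx y hy => by_contra fun hxy => hA ?_⟩
    obtain ⟨l₁, h₁, hl₁⟩ := exists_isSimpleCycle_of_perm (r := fun i j => A i j ≠ 0) π x
      fun z hz => hedge z (hz.mem_of_fixes_compl hπ hx)
    obtain ⟨l₂, h₂, hl₂⟩ := exists_isSimpleCycle_of_perm (r := fun i j => A i j ≠ 0) π y
      fun z hz => hedge z (hz.mem_of_fixes_compl hπ hy)
    exact ⟨l₁, l₂, h₁, h₂, fun v hv₁ hv₂ => hxy ((hl₁ v hv₁).trans (hl₂ v hv₂).symm)⟩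
end

section
/- For every natural number n ≥ 1 there exists a digraph r on a vertex type of cardinality n such that r contains no two vertex-disjoint simple cycles and r has exactly 2^{n-1} simple cycles counted up to cyclic rotation (equivalently, exactly 2^{n-1} distinct edge sets of simple cycles). -/
/-- The edge set `{(v₀,v₁), …, (v_{k-2},v_{k-1}), (v_{k-1},v₀)}` of the cycle
`l = [v₀, …, v_{k-1}]`, obtained by zipping `l` with its rotation by one;
a simple cycle is determined up to cyclic rotation by its edge set. -/
def cycleEdgeSet {V : Type*} (l : List V) : Set (V × V) :=
  {p | p ∈ l.zip (l.rotate 1)}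

/-- The digraph on `{0, …, m}` in which every vertex points to `0` and to all larger vertices. -/
def ascendOrReset (m : ℕ) (i j : Fin (m + 1)) : Prop := j = 0 ∨ i < j

/-- The cycle of `ascendOrReset m` through `0` and the successors of the elements of `T`. -/
def ascendingCycle {m : ℕ} (T : Finset (Fin m)) : List (Fin (m + 1)) :=
  0 :: (T.sort (· ≤ ·)).map Fin.succ

theorem pairwise_lt_of_isChain_ascendOrReset {m : ℕ} {x : Fin (m + 1)} {t : List (Fin (m + 1))}
    (h : List.IsChain (ascendOrReset m) (x :: t)) (h0 : (0 : Fin (m + 1)) ∉ t) :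
    (x :: t).Pairwise (· < ·) := by
  rw [← List.isChain_iff_pairwise]
  induction t generalizing x with
  | nil => simp
  | cons y t ih =>
    rw [List.isChain_cons_cons] at h ⊢
    simp only [List.mem_cons, not_or] at h0
    exact ⟨h.1.resolve_left (Ne.symm h0.1), ih h.2 h0.2⟩

theorem IsSimpleCycle.zero_mem {m : ℕ} {l : List (Fin (m + 1))}
    (h : IsSimpleCycle (ascendOrReset m) l) : (0 : Fin (m + 1)) ∈ l := by
  obtain ⟨hne, -, hc⟩ := h
  by_contra h0
  cases l with
  | nil => exact hne rfl
  | cons x t =>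
    have hp := pairwise_lt_of_isChain_ascendOrReset (x := x) (t := t ++ [x]) hc
      (by simpa [and_comm] using h0)
    exact lt_irrefl x ((List.pairwise_cons.1 hp).1 x (by simp))

theorem cycleEdgeSet_rotate {V : Type*} (l : List V) (k : ℕ) :
    cycleEdgeSet (l.rotate k) = cycleEdgeSet l := by
  have h : (l.rotate k).zip ((l.rotate k).rotate 1) = (l.zip (l.rotate 1)).rotate k := by
    rw [List.rotate_rotate, add_comm, ← List.rotate_rotate]
    exact (List.zipWith_rotate_distrib Prod.mk l (l.rotate 1) k (by simp)).symm
  ext p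
  simp only [cycleEdgeSet, h, Set.mem_ofPred_eq, List.mem_rotate]

theorem image_fst_cycleEdgeSet {V : Type*} (l : List V) :
    Prod.fst '' cycleEdgeSet l = {v | v ∈ l} := by
  have h : (l.zip (l.rotate 1)).map Prod.fst = l := List.map_fst_zip (by simp)
  ext v
  conv_rhs => rw [← h]
  simp [cycleEdgeSet]

theorem mem_ascendingCycle_succ {m : ℕ} {T : Finset (Fin m)} {i : Fin m} :
    i.succ ∈ ascendingCycle T ↔ i ∈ T := by
  simp [ascendingCycle]

theorem cycleEdgeSet_ascendingCycle_injective (m : ℕ) :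
    Function.Injective fun T : Finset (Fin m) => cycleEdgeSet (ascendingCycle T) := by
  intro S T h
  have h' := congrArg (Prod.fst '' ·) h
  simp only [image_fst_cycleEdgeSet] at h'
  ext i
  rw [← mem_ascendingCycle_succ, ← mem_ascendingCycle_succ]
  exact Set.ext_iff.1 h' i.succ

theorem pairwise_lt_ascendingCycle {m : ℕ} (T : Finset (Fin m)) :
    (ascendingCycle T).Pairwise (· < ·) := by
  refine List.pairwise_cons.2 ⟨by simp, ?_⟩
  exact List.pairwise_map.2 ((Finset.sortedLT_sort T).pairwise.imp Fin.succ_lt_succ_iff.2)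

theorem isSimpleCycle_ascendingCycle {m : ℕ} (T : Finset (Fin m)) :
    IsSimpleCycle (ascendOrReset m) (ascendingCycle T) := by
  have hp := pairwise_lt_ascendingCycle T
  refine ⟨by simp [ascendingCycle], hp.imp ne_of_lt, ?_⟩
  refine List.IsChain.append (hp.isChain.imp fun _ _ => Or.inr) (by simp [ascendingCycle]) ?_
  intro _ _ y hy
  exact Or.inl (by simpa [ascendingCycle, eq_comm] using hy)

theorem exists_eq_ascendingCycle {m : ℕ} {t : List (Fin (m + 1))}
    (h : (0 :: t).Pairwise (· < ·)) : ∃ T : Finset (Fin m), 0 :: t = ascendingCycle T := by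
  refine ⟨Finset.univ.filter fun i => i.succ ∈ t, ?_⟩
  refine List.Perm.eq_of_pairwise (le := (· < ·)) (fun a b _ _ hab hba => (lt_asymm hab hba).elim)
    h (pairwise_lt_ascendingCycle _) ?_
  rw [List.perm_ext_iff_of_nodup (h.imp ne_of_lt) ((pairwise_lt_ascendingCycle _).imp ne_of_lt)]
  intro v
  refine Fin.cases (by simp [ascendingCycle]) (fun i => ?_) v
  rw [mem_ascendingCycle_succ]
  simp

theorem IsSimpleCycle.exists_rotate_eq_ascendingCycle {m : ℕ} {l : List (Fin (m + 1))}
    (h : IsSimpleCycle (ascendOrReset m) l) :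
    ∃ (k : ℕ) (T : Finset (Fin m)), l.rotate k = ascendingCycle T := by
  obtain ⟨a, b, rfl⟩ := List.append_of_mem h.zero_mem
  obtain ⟨-, hnd, hc⟩ := h
  refine ⟨a.length, ?_⟩
  rw [List.rotate_append_length_eq]
  refine exists_eq_ascendingCycle (t := b ++ a) (pairwise_lt_of_isChain_ascendOrReset ?_ ?_)
  · cases a with
    | nil => simpa using List.IsChain.left_of_append hc
    | cons x a =>
      have hc' : List.IsChain (ascendOrReset m) ((x :: a) ++ (0 :: b ++ [x])) := by
        simpa [List.Chain'] using hc
      exact List.isChain_split.2 ⟨hc'.right_of_append, hc'.left_of_append⟩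
  · have := List.nodup_middle.1 hnd
    simp only [List.nodup_cons, List.mem_append] at this ⊢
    tauto

/-- For every `n ≥ 1` there is a digraph on a finite vertex type of
cardinality `n` with no two vertex-disjoint simple cycles and exactly `2^(n-1)` simple
cycles counted up to cyclic rotation (i.e. `2^(n-1)` distinct edge sets of simple
cycles). -/
theorem exists_digraph_achieving_cycle_bound (n : ℕ) (hn : 1 ≤ n) :
    ∃ (V : Type) (_ : Finite V) (r : V → V → Prop),
      Nat.card V = n ∧
      (¬ ∃ l₁ l₂ : List V,
          IsSimpleCycle r l₁ ∧ IsSimpleCycle r l₂ ∧ ∀ v ∈ l₁, v ∉ l₂) ∧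
      Set.ncard {E : Set (V × V) | ∃ l, IsSimpleCycle r l ∧ E = cycleEdgeSet l}
        = 2 ^ (n - 1) := by
  obtain ⟨m, rfl⟩ := Nat.exists_eq_add_of_le' hn
  refine ⟨Fin (m + 1), inferInstance, ascendOrReset m, by simp, ?_, ?_⟩
  · rintro ⟨l₁, l₂, h₁, h₂, h⟩
    exact h 0 h₁.zero_mem h₂.zero_mem
  · have hE : {E | ∃ l, IsSimpleCycle (ascendOrReset m) l ∧ E = cycleEdgeSet l} =
        Set.range fun T : Finset (Fin m) => cycleEdgeSet (ascendingCycle T) := by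
      ext E
      constructor
      · rintro ⟨l, hl, rfl⟩
        obtain ⟨k, T, hT⟩ := hl.exists_rotate_eq_ascendingCycle
        exact ⟨T, by simp only [← hT, cycleEdgeSet_rotate]⟩
      · rintro ⟨T, rfl⟩
        exact ⟨_, isSimpleCycle_ascendingCycle T, rfl⟩
    rw [hE, ← Nat.card_coe_set_eq,
      Nat.card_range_of_injective (cycleEdgeSet_ascendingCycle_injective m)]
    simp
end

section
/- Let V be a finite type and r : V → V → Prop an acyclic digraph (no simple cycles). If p and q are two simple directed paths in r (lists of pairwise distinct vertices with r holding between consecutive entries) whose sets of vertices are equal, then p = q as lists. That is, in a finite directed acyclic graph, a simple directed path is uniquely determined by its set of vertices. -/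
/-- A simple directed path of the digraph `r`: a list of pairwise distinct vertices
with `r` holding between consecutive entries. -/
def IsSimplePath {V : Type*} (r : V → V → Prop) (l : List V) : Prop :=
  l.Nodup ∧ List.Chain' r l

theorem List.exists_eq_append_of_not_nodup {α : Type*} {l : List α} (h : ¬ l.Nodup) :
    ∃ (x : α) (l₁ l₂ l₃ : List α), l = l₁ ++ (x :: l₂ ++ [x]) ++ l₃ := by
  induction l with
  | nil => simp at h
  | cons a t ih =>
    by_cases ha : a ∈ t
    · obtain ⟨s, u, rfl⟩ := List.append_of_mem ha
      exact ⟨a, [], s, u, by simp⟩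
    · obtain ⟨x, l₁, l₂, l₃, rfl⟩ := ih fun ht => h (List.nodup_cons.2 ⟨ha, ht⟩)
      exact ⟨x, a :: l₁, l₂, l₃, by simp⟩

/-- Every nonempty closed walk yields a simple cycle. -/
theorem exists_isSimpleCycle_of_isChain {V : Type*} {r : V → V → Prop} (l : List V)
    (hne : l ≠ []) (hl : List.IsChain r (l ++ l.take 1)) : ∃ c, IsSimpleCycle r c := by
  by_cases hd : l.Nodup
  · exact ⟨l, hne, hd, hl⟩
  · obtain ⟨x, l₁, l₂, l₃, h⟩ := List.exists_eq_append_of_not_nodup hd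
    have hlen : (x :: l₂).length < l.length := by simp [h]; omega
    refine exists_isSimpleCycle_of_isChain (x :: l₂) (by simp) ?_
    have hc : List.IsChain r l := hl.left_of_append
    rw [h] at hc
    simpa using hc.left_of_append.right_of_append
termination_by l.length

theorem exists_isSimpleCycle_of_transGen {V : Type*} {r : V → V → Prop} {a : V}
    (h : Relation.TransGen r a a) : ∃ c, IsSimpleCycle r c := by
  obtain ⟨b, hab, hba⟩ := Relation.TransGen.tail'_iff.1 h
  obtain ⟨l, hl, hlast⟩ := List.exists_isChain_cons_of_relationReflTransGen hab
  refine exists_isSimpleCycle_of_isChain (a :: l) (by simp) ?_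
  refine hl.append (by simp) ?_
  simp [List.getLast?_eq_getLast_of_ne_nil, hlast, hba]

/-- In a finite acyclic digraph (no simple cycles), a simple directed
path is uniquely determined by its set of vertices: two simple paths with the same
vertices are equal as lists. -/
theorem simple_path_unique_of_acyclic {V : Type*} [Fintype V] (r : V → V → Prop)
    (hacyc : ¬ ∃ l : List V, IsSimpleCycle r l)
    (p q : List V) (hp : IsSimplePath r p) (hq : IsSimplePath r q)
    (hset : ∀ x, x ∈ p ↔ x ∈ q) : p = q := by
  have pairwise {l : List V} (hl : IsSimplePath r l) : l.Pairwise (Relation.TransGen r) :=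
    List.isChain_iff_pairwise.1 (List.IsChain.imp (fun _ _ => Relation.TransGen.single) hl.2)
  refine List.Perm.eq_of_pairwise (fun a b _ _ hab hba => ?_) (pairwise hp) (pairwise hq)
    ((List.perm_ext_iff_of_nodup hp.1 hq.1).2 hset)
  exact (hacyc (exists_isSimpleCycle_of_transGen (hab.trans hba))).elim
end

section
/- Let k be an algebraically closed field, d ≥ 1, and let A and B be d × d matrices over k with AB = BA. Then the unital k-subalgebra of the matrix algebra generated by A and B has dimension at most d as a k-vector space. -/
open Polynomial
open scoped Matrix

/-- Linear independence of a family of vectors depending polynomially on a parameter is an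
open condition on the parameter. -/
theorem exists_ne_zero_forall_eval_ne_zero_linearIndependent {k ι σ : Type*} [Field k]
    [Finite ι] [Fintype σ] (P : ι → σ → k[X]) (t₀ : k)
    (h : LinearIndependent k fun i a => (P i a).eval t₀) :
    ∃ q : k[X], q ≠ 0 ∧ ∀ t, q.eval t ≠ 0 → LinearIndependent k fun i a => (P i a).eval t := by
  classical
  have := Fintype.ofFinite ι
  have hrow : LinearIndependent k (Matrix.of fun i a => (P i a).eval t₀)ᵀ.col := h
  obtain ⟨Q, hQ⟩ : ∃ Q : Matrix ι σ k, Q * (Matrix.of fun i a => (P i a).eval t₀)ᵀ = 1 := by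
    obtain ⟨g, hg⟩ := (Matrix.toLin' (Matrix.of fun i a => (P i a).eval t₀)ᵀ)
      |>.exists_leftInverse_of_injective
        (LinearMap.ker_eq_bot.mpr (Matrix.mulVec_injective_iff.mpr hrow))
    refine ⟨LinearMap.toMatrix' g, Matrix.toLin'.injective ?_⟩
    rw [Matrix.toLin'_mul, Matrix.toLin'_toMatrix', hg, Matrix.toLin'_one]
  have heval (t : k) : ((Q.map C * (Matrix.of P)ᵀ).det).eval t =
      (Q * (Matrix.of fun i a => (P i a).eval t)ᵀ).det := by
    rw [← coe_evalRingHom, RingHom.map_det, RingHom.mapMatrix_apply, Matrix.map_mul]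
    congr 2
    ext; simp
  refine ⟨(Q.map C * (Matrix.of P)ᵀ).det, fun h0 => ?_, fun t ht => ?_⟩
  · have := heval t₀
    simp [h0, hQ] at this
  · rw [heval, ← isUnit_iff_ne_zero, ← Matrix.isUnit_iff_isUnit_det] at ht
    have hinj := Matrix.mulVec_injective_of_isUnit ht
    have : LinearIndependent k (Matrix.of fun i a => (P i a).eval t)ᵀ.col := by
      rw [← Matrix.mulVec_injective_iff]
      refine .of_comp (f := Q.mulVec) ?_
      simpa [Function.comp_def] using hinj
    exact this

/-- A space of matrices commuting with a matrix `C` that has a cyclic vector has dimension at most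
the size of `C`. -/
theorem Matrix.finrank_le_of_commute_of_linearIndependent {k : Type*} [Field k] {d : ℕ}
    (C : Matrix (Fin d) (Fin d) k) (v : Fin d → k)
    (hv : LinearIndependent k fun i : Fin d => (C ^ (i : ℕ)).mulVec v)
    (S : Submodule k (Matrix (Fin d) (Fin d) k)) (hS : ∀ M ∈ S, Commute M C) :
    Module.finrank k S ≤ d := by
  let φ : S →ₗ[k] (Fin d → k) :=
    (LinearMap.applyₗ v ∘ₗ (Matrix.toLin' (R := k)).toLinearMap) ∘ₗ S.subtype
  have hφ : Function.Injective φ := by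
    rw [injective_iff_map_eq_zero]
    rintro ⟨M, hM⟩ h
    replace h : M.mulVec v = 0 := by simpa [φ] using h
    have hspan := hv.span_eq_top_of_card_eq_finrank' (by simp)
    have : Matrix.toLin' M = 0 := by
      refine LinearMap.ext_on_range hspan fun i => ?_
      rw [Matrix.toLin'_apply, Matrix.mulVec_mulVec, ((hS M hM).pow_right (i : ℕ)).eq,
        ← Matrix.mulVec_mulVec, h, Matrix.mulVec_zero, LinearMap.zero_apply]
    simpa using this
  simpa using LinearMap.finrank_le_finrank_of_injective hφ

/-- Every endomorphism of a finite-dimensional space over an algebraically closed field commutes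
with an endomorphism that has a cyclic vector. -/
theorem Module.End.exists_commute_linearIndependent_pow_apply {k V : Type*} [Field k]
    [IsAlgClosed k] [AddCommGroup V] [Module k V] [FiniteDimensional k V] (f : Module.End k V) :
    ∃ (g : Module.End k V) (v : V), Commute f g ∧
      LinearIndependent k fun i : Fin (Module.finrank k V) => (g ^ (i : ℕ)) v := by
  classical
  obtain ⟨ι, _, p, hp, e, ⟨E₀⟩⟩ := Module.equiv_directSum_of_isTorsion
    (Module.AEval.isTorsion_of_finiteDimensional k V f)
  have hdeg (i) : (p i).degree = 1 := IsAlgClosed.degree_eq_one_of_irreducible k (hp i)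
  choose a ha using fun i => IsAlgClosed.exists_root (p i) (by rw [hdeg i]; simp)
  have hdvd (i) : X - C (a i) ∣ p i := dvd_iff_isRoot.mpr (ha i)
  let b : ι ↪ k := (Fintype.equivFin ι).toEmbedding.trans
    (Fin.valEmbedding.trans (Infinite.natEmbedding k))
  let N : Type _ := (i : ι) → k[X] ⧸ Ideal.span {p i ^ e i}
  let E₁ : Module.AEval k V f ≃ₗ[k[X]] N := E₀ ≪≫ₗ DirectSum.linearEquivFunOnFintype _ _ _
  let E : V ≃ₗ[k] N := Module.AEval.of k V f ≪≫ₗ E₁.restrictScalars k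
  have hE (x : V) : E (f x) = (X : k[X]) • E x := by
    exact (congrArg E₁ (Module.AEval.X_smul_of f x).symm).trans (E₁.map_smul _ _)
  let G : N →ₗ[k[X]] N :=
    LinearMap.pi fun i => (X + C (b i - a i) : k[X]) • LinearMap.proj i
  let w : N := fun i => Ideal.Quotient.mk _ 1
  have hG (n : ℕ) : ((G.restrictScalars k) ^ n) w =
      fun i => Ideal.Quotient.mk _ ((X + C (b i - a i)) ^ n) := by
    induction n with
    | zero => rfl
    | succ n ih =>
      rw [pow_succ', Module.End.mul_apply, ih]
      funext i
      rw [pow_succ']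
      rfl
  have hg (n : ℕ) : E (((E.symm.conj (G.restrictScalars k)) ^ n) (E.symm w)) =
      fun i => Ideal.Quotient.mk _ ((X + C (b i - a i)) ^ n) := by
    rw [← hG]
    induction n with
    | zero => simp
    | succ n ih =>
      rw [pow_succ', Module.End.mul_apply, pow_succ', Module.End.mul_apply, ← ih]
      simp [LinearEquiv.conj_apply]
  have hdim : Module.finrank k V = ∑ i, e i := by
    have (i : ι) : Module.Finite k (k[X] ⧸ Ideal.span {p i ^ e i}) :=
      (AdjoinRoot.powerBasis (pow_ne_zero (e i) (hp i).ne_zero)).finite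
    rw [E.finrank_eq, Module.finrank_pi_fintype]
    refine Finset.sum_congr rfl fun i _ => ?_
    rw [finrank_quotient_span_eq_natDegree, natDegree_pow, natDegree_eq_of_degree_eq_some (n := 1) (hdeg i), mul_one]
  refine ⟨E.symm.conj (G.restrictScalars k), E.symm w, ?_, ?_⟩
  · ext x
    apply E.injective
    simp only [Module.End.mul_apply, hE]
    simp only [LinearEquiv.conj_apply_apply, LinearEquiv.symm_symm, LinearEquiv.apply_symm_apply,
      hE, LinearMap.restrictScalars_apply, map_smul]
  · rw [Fintype.linearIndependent_iff]
    intro c hc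
    set q : k[X] := ∑ j : Fin (Module.finrank k V), C (c j) * X ^ (j : ℕ) with hq
    have hqdvd (i : ι) : (X - C (b i)) ^ e i ∣ q := by
      have h1 := congrFun (congrArg E hc) i
      rw [map_sum, map_zero] at h1
      simp only [map_smul, hg] at h1
      have h2 : Ideal.Quotient.mk (Ideal.span {p i ^ e i}) (q.comp (X + C (b i - a i))) = 0 := by
        refine Eq.trans ?_ h1
        rw [Finset.sum_apply, hq, sum_comp, map_sum]
        refine Finset.sum_congr rfl fun j _ => ?_
        simp only [mul_comp, C_comp, pow_comp, X_comp]
        rw [← smul_eq_C_mul]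
        rfl
      rw [Ideal.Quotient.eq_zero_iff_mem, Ideal.mem_span_singleton] at h2
      obtain ⟨r, hr⟩ := (pow_dvd_pow_of_dvd (hdvd i) (e i)).trans h2
      refine ⟨r.comp (X - C (b i - a i)), ?_⟩
      have h3 := congrArg (fun s : k[X] => s.comp (X - C (b i - a i))) hr
      simp only [comp_assoc, mul_comp, pow_comp, add_comp, sub_comp, X_comp, C_comp,
        sub_add_cancel, comp_X] at h3
      rw [h3]
      congr 2
      rw [C_sub]
      ring
    have hprod : ∏ i, (X - C (b i)) ^ e i ∣ q :=
      Finset.prod_dvd_of_coprime (fun i _ j _ hij =>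
        (pairwise_coprime_X_sub_C b.injective hij).pow) fun i _ => hqdvd i
    have hq0 : q = 0 := by
      refine eq_zero_of_dvd_of_degree_lt hprod ?_
      rw [degree_prod]
      simp only [degree_pow, degree_X_sub_C, nsmul_eq_mul, mul_one]
      rw [← Nat.cast_sum, ← hdim]
      exact degree_sum_fin_lt c
    intro j
    have := congrArg (fun s : k[X] => s.coeff j) hq0
    simpa [hq, finsetSum_coeff, coeff_C_mul, coeff_X_pow, Fin.val_inj] using this

/-- Every square matrix over an algebraically closed field commutes with a matrix that has a cyclic
vector. -/
theorem Matrix.exists_commute_linearIndependent_pow_mulVec {k : Type*} [Field k]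
    [IsAlgClosed k] {d : ℕ} (A : Matrix (Fin d) (Fin d) k) :
    ∃ (R : Matrix (Fin d) (Fin d) k) (v : Fin d → k), Commute A R ∧
      LinearIndependent k fun i : Fin d => (R ^ (i : ℕ)).mulVec v := by
  obtain ⟨g, v, hg, hv⟩ :=
    Module.End.exists_commute_linearIndependent_pow_apply (Matrix.toLinAlgEquiv' A)
  refine ⟨Matrix.toLinAlgEquiv'.symm g, v, ?_, ?_⟩
  · simpa using hg.map (Matrix.toLinAlgEquiv' (R := k) (n := Fin d)).symm
  · rw [Module.finrank_fin_fun] at hv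
    have h (i : ℕ) : (Matrix.toLinAlgEquiv'.symm g ^ i).mulVec v = (g ^ i) v := by
      rw [← map_pow, ← Matrix.toLinAlgEquiv'_apply, AlgEquiv.apply_symm_apply]
    simpa only [h] using hv

/-- Over an algebraically closed field `k`, if `A` and `B` are
commuting `d × d` matrices (`d ≥ 1`), then the unital `k`-subalgebra of the matrix
algebra generated by `A` and `B` has dimension at most `d` as a `k`-vector space. -/
theorem finrank_adjoin_pair_le {k : Type*} [Field k] [IsAlgClosed k] {d : ℕ}
    (hd : 1 ≤ d) (A B : Matrix (Fin d) (Fin d) k) (hAB : A * B = B * A) :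
    Module.finrank k (Algebra.adjoin k ({A, B} : Set (Matrix (Fin d) (Fin d) k))) ≤ d := by
  obtain ⟨R, v, hAR, hv⟩ := A.exists_commute_linearIndependent_pow_mulVec
  let ev (t : k) : Matrix (Fin d) (Fin d) k[X] →ₐ[k] Matrix (Fin d) (Fin d) k :=
    (aeval t : k[X] →ₐ[k] k).mapMatrix
  have hev_map (t : k) (M : Matrix (Fin d) (Fin d) k) : ev t (M.map C) = M := by
    ext; simp [ev]
  let Z : Matrix (Fin d) (Fin d) k[X] := B.map C + (X : k[X]) • (R - B).map C
  have hZ (t : k) : ev t Z = B + t • (R - B) := by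
    ext; simp [Z, ev]
  let Φ : FreeAlgebra k Bool →ₐ[k] Matrix (Fin d) (Fin d) k[X] :=
    FreeAlgebra.lift k fun c => cond c Z (A.map C)
  have hrange (t : k) : ((ev t).comp Φ).range = Algebra.adjoin k {A, ev t Z} := by
    have : (ev t).comp Φ = FreeAlgebra.lift k fun c => cond c (ev t Z) A := by
      ext c
      cases c <;> simp [Φ, hev_map]
    rw [this, ← Algebra.adjoin_range_eq_range_freeAlgebra_lift, Bool.range_eq]
    rfl
  have hcomm (t : k) (M) (hM : M ∈ Algebra.adjoin k {A, ev t Z}) : Commute M (ev t Z) := by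
    refine (Algebra.commute_of_mem_adjoin_of_forall_mem_commute hM ?_).symm
    rintro N (rfl | rfl)
    · rw [hZ]
      exact ((show Commute N B from hAB).add_right
        ((hAR.sub_right hAB).smul_right t)).symm
    · exact Commute.refl _
  by_contra! hlt
  obtain ⟨s, hs⟩ := exists_linearIndependent_of_le_finrank (Nat.succ_le_of_lt hlt)
  have hs' := hs.map' (Subalgebra.toSubmodule (Algebra.adjoin k {A, B})).subtype
    (Submodule.ker_subtype _)
  have hZ0 : ev 0 Z = B := by simp [hZ]
  have hZ1 : ev 1 Z = R := by simp [hZ]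
  choose P hP using fun i => (hZ0 ▸ hrange 0).ge (s i).2
  let unc : Matrix (Fin d) (Fin d) k ≃ₗ[k] (Fin d × Fin d → k) :=
    (LinearEquiv.curry k k (Fin d) (Fin d)).symm
  obtain ⟨q₀, hq₀, H₀⟩ := exists_ne_zero_forall_eval_ne_zero_linearIndependent
    (fun i (x : Fin d × Fin d) => Φ (P i) x.1 x.2) 0 (by
      have h : (fun i (x : Fin d × Fin d) => (Φ (P i) x.1 x.2).eval 0) =
          unc.toLinearMap ∘ (Subalgebra.toSubmodule (Algebra.adjoin k {A, B})).subtype ∘ s := by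
        funext i x
        exact congrFun (congrFun (hP i) x.1) x.2
      rw [h]
      exact hs'.map' unc.toLinearMap unc.ker)
  have heval_mulVec (t : k) (i : ℕ) (a : Fin d) :
      ((Z ^ i).mulVec (fun j => C (v j)) a).eval t = (ev t Z ^ i).mulVec v a := by
    rw [← map_pow]
    simp [Matrix.mulVec, dotProduct, eval_finsetSum, ev, coe_aeval_eq_eval]
  obtain ⟨q₁, hq₁, H₁⟩ := exists_ne_zero_forall_eval_ne_zero_linearIndependent
    (fun (i : Fin d) => (Z ^ (i : ℕ)).mulVec fun j => C (v j)) 1 (by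
      simpa only [heval_mulVec, hZ1] using hv)
  obtain ⟨t, ht⟩ : ∃ t, (q₀ * q₁).eval t ≠ 0 := by
    by_contra! h
    exact mul_ne_zero hq₀ hq₁ (Polynomial.funext fun t => by simp [h t])
  rw [eval_mul, mul_ne_zero_iff] at ht
  have hle := Matrix.finrank_le_of_commute_of_linearIndependent (ev t Z) v
    (by simpa only [heval_mulVec] using H₁ t ht.2)
    (Subalgebra.toSubmodule (Algebra.adjoin k {A, ev t Z})) (hcomm t)
  have hli : LinearIndependent k fun i =>
      (⟨ev t (Φ (P i)), hrange t ▸ ⟨P i, rfl⟩⟩ : Algebra.adjoin k {A, ev t Z}) := by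
    refine .of_comp (unc.toLinearMap ∘ₗ (Algebra.adjoin k {A, ev t Z}).val.toLinearMap) ?_
    exact H₀ t ht.1
  have := hli.fintype_card_le_finrank
  rw [Fintype.card_fin] at this
  exact absurd (this.trans hle) (by simp)
end

section
/- Let R be a commutative ring, Σ a type, and let μ₁ : Σ → Mat_{d₁}(R) and μ₂, κ₂ : Σ → Mat_{d₂}(R) be families of square matrices satisfying: (i) μ₁(a)μ₁(b) = μ₁(b)μ₁(a) and μ₂(a)μ₂(b) = μ₂(b)μ₂(a) for all a, b; (ii) κ₂(a)κ₂(a) = κ₂(a) for all a; (iii) κ₂(a)κ₂(b) = κ₂(b)κ₂(a) for all a, b; (iv) μ₂(a)κ₂(a) = 0 for all a; (v) μ₂(a)κ₂(b) = κ₂(b)μ₂(a) whenever a ≠ b. Then for every list w over Σ, the ordered product ∏_{a ∈ w} (μ₁(a) ⊗ κ₂(a) + I ⊗ μ₂(a)) equals the sum, over all pairs of multisets (u, v) with u + v equal to the multiset of entries of w, of μ₁(u) ⊗ (κ₂(u) · μ₂(v)), where μ₁(u) and μ₂(v) denote the (well-defined, by commutativity) products of μ₁ over the elements of u and of μ₂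 over the elements of v, κ₂(u) denotes the product of κ₂(a) over the distinct symbols a occurring in u, and ⊗ is the Kronecker product of matrices. -/
open Kronecker

/-- The pairs summing to `a ::ₘ s` are those obtained by adding `a` to the first component,
together with those obtained by adding `a` to the second component when the first avoids `a`. -/
theorem sum_antidiagonal_cons_toFinset {α β : Type*} [DecidableEq α] [AddCommMonoid β]
    (a : α) (s : Multiset α) (f : Multiset α × Multiset α → β) :
    ∑ p ∈ (Multiset.antidiagonal (a ::ₘ s)).toFinset, f p =
      ∑ p ∈ (Multiset.antidiagonal s).toFinset,
        (f (a ::ₘ p.1, p.2) + if a ∈ p.1 then 0 else f (p.1, a ::ₘ p.2)) := by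
  have hunion : (Multiset.antidiagonal (a ::ₘ s)).toFinset =
      (Multiset.antidiagonal s).toFinset.image (fun p => (a ::ₘ p.1, p.2)) ∪
        ((Multiset.antidiagonal s).toFinset.filter (fun p => a ∉ p.1)).image
          (fun p => (p.1, a ::ₘ p.2)) := by
    ext ⟨u, v⟩
    simp only [Multiset.mem_toFinset, Multiset.mem_antidiagonal, Finset.mem_union,
      Finset.mem_image, Finset.mem_filter, Prod.mk.injEq, Prod.exists]
    constructor
    · intro h
      by_cases ha : a ∈ u
      · obtain ⟨u, rfl⟩ := Multiset.exists_cons_of_mem ha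
        exact Or.inl ⟨u, v, by simpa using h, rfl, rfl⟩
      · have hv : a ∈ v := by
          have : a ∈ u + v := h ▸ Multiset.mem_cons_self a s
          exact (Multiset.mem_add.mp this).resolve_left ha
        obtain ⟨v, rfl⟩ := Multiset.exists_cons_of_mem hv
        exact Or.inr ⟨u, v, ⟨by simpa using h, ha⟩, rfl, rfl⟩
    · rintro (⟨u, v, rfl, rfl, rfl⟩ | ⟨u, v, ⟨rfl, -⟩, rfl, rfl⟩) <;> simp
  have hdisj : Disjoint
      ((Multiset.antidiagonal s).toFinset.image (fun p => (a ::ₘ p.1, p.2)))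
      (((Multiset.antidiagonal s).toFinset.filter (fun p => a ∉ p.1)).image
        (fun p => (p.1, a ::ₘ p.2))) := by
    simp only [Finset.disjoint_left, Finset.mem_image, Finset.mem_filter]
    rintro _ ⟨p, -, rfl⟩ ⟨q, ⟨-, hq⟩, h⟩
    exact hq ((congrArg Prod.fst h : q.1 = a ::ₘ p.1) ▸ Multiset.mem_cons_self a p.1)
  rw [hunion, Finset.sum_union hdisj, Finset.sum_image, Finset.sum_image, Finset.sum_add_distrib,
    Finset.sum_filter]
  · simp only [ite_not]
  · rintro ⟨u, v⟩ - ⟨u', v'⟩ - h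
    simpa using h
  · rintro ⟨u, v⟩ - ⟨u', v'⟩ - h
    simpa using h

section DistinctProduct

variable {α A : Type*} [DecidableEq α] {κ : α → A} {K : Multiset α → A}

/-- A product of commuting idempotents over the distinct elements of a multiset absorbs each of
its factors. -/
theorem mul_distinctProd_of_mem [Semigroup A] (hidem : ∀ a, κ a * κ a = κ a)
    (hcomm : ∀ a b, κ a * κ b = κ b * κ a)
    (hK : ∀ a u, K (a ::ₘ u) = if a ∈ u then K u else κ a * K u)
    {a : α} {u : Multiset α} (ha : a ∈ u) : κ a * K u = K u := by
  induction u using Multiset.induction_on with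
  | empty => simp at ha
  | cons b u ih =>
    rw [hK]
    split_ifs with hb
    · exact ih ((Multiset.mem_cons.mp ha).elim (fun h => h ▸ hb) id)
    · rcases Multiset.mem_cons.mp ha with rfl | ha
      · rw [← mul_assoc, hidem]
      · rw [← mul_assoc, hcomm, mul_assoc, ih ha]

/-- An element commuting with every factor commutes with the product over distinct elements. -/
theorem commute_distinctProd [Monoid A] (hK0 : K 0 = 1)
    (hK : ∀ a u, K (a ::ₘ u) = if a ∈ u then K u else κ a * K u)
    {x : A} {u : Multiset α} (hx : ∀ b ∈ u, Commute x (κ b)) : Commute x (K u) := by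
  induction u using Multiset.induction_on with
  | empty => simp [hK0]
  | cons b u ih =>
    have hu := ih fun c hc => hx c (Multiset.mem_cons_of_mem hc)
    rw [hK]
    split_ifs
    · exact hu
    · exact (hx b (Multiset.mem_cons_self b u)).mul_right hu

end DistinctProduct

/-- Let `μ₁ : Σ → Mat_{d₁}(R)` and `μ₂, κ₂ : Σ → Mat_{d₂}(R)` satisfy:
(i) each of the families `μ₁` and `μ₂` commutes pairwise; (ii) each `κ₂ a` is
idempotent; (iii) the `κ₂` commute pairwise; (iv) `μ₂ a * κ₂ a = 0`;
(v) `μ₂ a * κ₂ b = κ₂ b * μ₂ a` for `a ≠ b`.  Let `M₁ u`, `M₂ u` denote the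
(well-defined, by commutativity) products of `μ₁`, `μ₂` over a multiset `u`, and `K₂ u`
the product of `κ₂ a` over the distinct symbols `a` occurring in `u` (these three
functions are specified by their recurrences).  Then for every list `w` over `Σ`, the
ordered product `∏_{a ∈ w} (μ₁ a ⊗ κ₂ a + I ⊗ μ₂ a)` equals the sum over all pairs of
multisets `(u, v)` with `u + v` equal to the multiset of entries of `w` of
`M₁ u ⊗ (K₂ u * M₂ v)`, where `⊗` is the Kronecker product. -/
theorem prod_kronecker_eq_sum_shuffle {R : Type*} [CommRing R] {Γ : Type*}
    [DecidableEq Γ] {d₁ d₂ : ℕ}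
    (μ₁ : Γ → Matrix (Fin d₁) (Fin d₁) R)
    (μ₂ κ₂ : Γ → Matrix (Fin d₂) (Fin d₂) R)
    (hμ₁ : ∀ a b, μ₁ a * μ₁ b = μ₁ b * μ₁ a)
    (hμ₂ : ∀ a b, μ₂ a * μ₂ b = μ₂ b * μ₂ a)
    (hκidem : ∀ a, κ₂ a * κ₂ a = κ₂ a)
    (hκcomm : ∀ a b, κ₂ a * κ₂ b = κ₂ b * κ₂ a)
    (hμκ : ∀ a, μ₂ a * κ₂ a = 0)
    (hμκcomm : ∀ a b, a ≠ b → μ₂ a * κ₂ b = κ₂ b * μ₂ a)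
    (M₁ : Multiset Γ → Matrix (Fin d₁) (Fin d₁) R)
    (M₂ : Multiset Γ → Matrix (Fin d₂) (Fin d₂) R)
    (K₂ : Multiset Γ → Matrix (Fin d₂) (Fin d₂) R)
    (hM₁0 : M₁ 0 = 1) (hM₁ : ∀ a u, M₁ (a ::ₘ u) = μ₁ a * M₁ u)
    (hM₂0 : M₂ 0 = 1) (hM₂ : ∀ a u, M₂ (a ::ₘ u) = μ₂ a * M₂ u)
    (hK₂0 : K₂ 0 = 1)
    (hK₂ : ∀ a u, K₂ (a ::ₘ u) = if a ∈ u then K₂ u else κ₂ a * K₂ u)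
    (w : List Γ) :
    (w.map fun a => μ₁ a ⊗ₖ κ₂ a + (1 : Matrix (Fin d₁) (Fin d₁) R) ⊗ₖ μ₂ a).prod =
      ∑ p ∈ (Multiset.antidiagonal (↑w : Multiset Γ)).toFinset,
        M₁ p.1 ⊗ₖ (K₂ p.1 * M₂ p.2) := by
  have hκK (a u) : κ₂ a * K₂ u = K₂ (a ::ₘ u) := by
    rw [hK₂]
    split_ifs with h
    · exact mul_distinctProd_of_mem hκidem hκcomm hK₂ h
    · rfl
  have hμK_mem {a u} (h : a ∈ u) : μ₂ a * K₂ u = 0 := by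
    rw [← mul_distinctProd_of_mem hκidem hκcomm hK₂ h, ← mul_assoc, hμκ, zero_mul]
  have hμK_notMem {a u} (h : a ∉ u) : μ₂ a * K₂ u = K₂ u * μ₂ a :=
    commute_distinctProd hK₂0 hK₂ fun b hb => hμκcomm a b fun hab => h (hab ▸ hb)
  induction w with
  | nil => simp [hM₁0, hM₂0, hK₂0]
  | cons a w ih =>
    rw [List.map_cons, List.prod_cons, ih, ← Multiset.cons_coe, sum_antidiagonal_cons_toFinset,
      Finset.mul_sum]
    refine Finset.sum_congr rfl fun p _ => ?_
    rw [add_mul, ← Matrix.mul_kronecker_mul, ← Matrix.mul_kronecker_mul, one_mul, ← mul_assoc,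
      ← mul_assoc, hκK, hM₁]
    split_ifs with h
    · rw [hμK_mem h, zero_mul, Matrix.kronecker_zero]
    · rw [hμK_notMem h, hM₂, mul_assoc (K₂ p.1)]
end
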